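/- Let k be an algebraically closed field, let A be a finitely generated k-algebra which is an integral domain of Krull dimension d, let m be a maximal ideal of A, and let I be a prime ideal of A with (0) ⊊ I ⊊ m such that the Krull dimension d₁ of the quotient ring A/I satisfies 0 < d₁ < d. Then there exists a k-algebra homomorphism φ : A → k⟦t⟧ into the formal power series ring such that the preimage under φ of the ideal (t) equals m, and I is not contained in the kernel of φ. -/

import Mathlib

/-- The expansion `v ↦ ∑ d (qⁿ v) tⁿ`; when `v = d v + w * q v` for all `v`, it expands `v` as a
power series in `w`. -/
noncomputable def digitExpansion {k V : Type*} [Field k] [CommRing V] [Algebra k V]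
    (d : V →ₐ[k] k) (q : V →ₗ[k] V)
    (hq : ∀ u v, q (u * v) = d u • q v + q u * v) : V →ₐ[k] PowerSeries k :=
  AlgHom.ofLinearMap
    { toFun := fun v => PowerSeries.mk fun n => d ((q ^ n) v)
      map_add' := fun u v => by ext; simp
      map_smul' := fun c v => by ext; simp }
    (by
      have h0 : q 1 = 0 := by simpa using hq 1 1
      ext n
      cases n with
      | zero => simp
      | succ n => simp [pow_succ, h0, PowerSeries.coeff_one])
    (by
      intro u v
      ext n
      simp only [LinearMap.coe_mk, AddHom.coe_mk, PowerSeries.coeff_mk, PowerSeries.coeff_mul]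
      induction n generalizing u v with
      | zero => simp
      | succ n ih =>
        rw [Finset.Nat.antidiagonal_succ]
        simp [pow_succ, hq, ih])

/-- A valuation ring over `k` that is finite modulo `s` maps to `k⟦t⟧`,
with kernel contained in every `(sⁿ)`. -/
theorem exists_algHom_powerSeries_of_finite_quotient {k V : Type*} [Field k] [IsAlgClosed k]
    [CommRing V] [IsDomain V] [ValuationRing V]
    [Algebra k V] (s : V) (hs0 : s ≠ 0) (hs : ¬ IsUnit s)
    [Module.Finite k (V ⧸ Ideal.span {s})] :
    ∃ φ : V →ₐ[k] PowerSeries k,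
      (∀ v, PowerSeries.X ∣ φ v ↔ v ∈ IsLocalRing.maximalIdeal V) ∧
      ∀ v, φ v = 0 → ∀ n, s ^ n ∣ v := by
  set M := IsLocalRing.maximalIdeal V with hM
  set S := Ideal.span {s} with hS
  have hSM : S ≤ M := by
    rw [hS, Ideal.span_singleton_le_iff_mem]
    exact (IsLocalRing.mem_maximalIdeal s).2 hs
  have hMfg : M.FG := by
    have : IsNoetherian V (V ⧸ S) := isNoetherian_of_tower k inferInstance
    refine Submodule.fg_of_fg_map_of_fg_inf_ker S.mkQ (IsNoetherian.noetherian _) ?_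
    rw [Submodule.ker_mkQ, inf_eq_right.2 hSM]
    exact ⟨{s}, by simp [hS]⟩
  obtain ⟨w, hw⟩ := (IsBezout.isPrincipal_of_FG M hMfg).principal
  have hw' : M = Ideal.span {w} := hw
  have hwS : ∃ N, s ∣ w ^ N := by
    have : IsArtinian V (V ⧸ S) := isArtinian_of_tower k inferInstance
    obtain ⟨N, y, hy⟩ := IsArtinian.exists_pow_succ_smul_dvd w (1 : V ⧸ S)
    obtain ⟨y, rfl⟩ := Ideal.Quotient.mk_surjective y
    have hu : IsUnit (1 - w * y) := by
      refine IsLocalRing.notMem_maximalIdeal.1 fun h => ?_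
      have hwy : w * y ∈ M := hw' ▸ Ideal.mul_mem_right _ _ (Ideal.mem_span_singleton_self w)
      exact (IsLocalRing.maximalIdeal.isMaximal V).ne_top
        ((Ideal.eq_top_iff_one _).2 (by simpa using add_mem h hwy))
    refine ⟨N, (hu.dvd_mul_right).1 (Ideal.mem_span_singleton.1 ?_)⟩
    have h : Ideal.Quotient.mk S (w ^ N) = Ideal.Quotient.mk S (w ^ (N + 1) * y) := by
      simpa [Algebra.smul_def] using hy.symm
    rw [Ideal.Quotient.mk_eq_mk_iff_sub_mem] at h
    convert h using 1
    ring
  obtain ⟨N, hN⟩ := hwS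
  have hw0 : w ≠ 0 := by
    rintro rfl
    rw [Ideal.span_singleton_eq_bot.2 rfl] at hw'
    exact hs0 (by simpa [hw'] using hSM (Ideal.mem_span_singleton_self s))
  have : Module.Finite k (V ⧸ M) :=
    Module.Finite.of_surjective (Ideal.Quotient.factorₐ k hSM).toLinearMap
      (Ideal.Quotient.factor_surjective hSM)
  have : IsDomain (V ⧸ M) := Ideal.Quotient.isDomain M
  let e : k ≃ₐ[k] (V ⧸ M) :=
    AlgEquiv.ofBijective (Algebra.ofId k _) IsAlgClosed.algebraMap_bijective_of_isIntegral
  let d : V →ₐ[k] k := e.symm.toAlgHom.comp (Ideal.Quotient.mkₐ k M)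
  have hd : ∀ v, d v = 0 ↔ v ∈ M := fun v => by
    simp [d, Ideal.Quotient.eq_zero_iff_mem]
  have hex : ∀ v, ∃ v', v = algebraMap k V (d v) + w * v' := fun v => by
    have : v - algebraMap k V (d v) ∈ M := (hd _).1 (by simp)
    rw [hw', Ideal.mem_span_singleton] at this
    obtain ⟨v', h⟩ := this
    exact ⟨v', by rw [← h]; ring⟩
  choose q hq using hex
  have key : ∀ v c x, v = algebraMap k V c + w * x → d v = c → q v = x := by
    rintro v c x h rfl
    have := (hq v).symm.trans h
    exact mul_left_cancel₀ hw0 (add_left_cancel this)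
  let Q : V →ₗ[k] V :=
    { toFun := q
      map_add' := fun u v => key _ (d u + d v) _ (by
        conv_lhs => rw [hq u, hq v]
        simp only [map_add]; ring) (by simp)
      map_smul' := fun c v => key _ (c * d v) _ (by
        conv_lhs => rw [hq v]
        simp only [map_mul, Algebra.smul_def, RingHom.id_apply]; ring) (by simp) }
  have hQ : ∀ u v, Q (u * v) = d u • Q v + Q u * v := fun u v =>
    key _ (d u * d v) _ (by
      change _ = _ + w * (d u • q v + q u * v)
      conv_lhs => rw [hq u]
      nth_rewrite 1 [add_mul, hq v]
      simp only [map_mul, Algebra.smul_def]; ring) (by simp)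
  refine ⟨digitExpansion d Q hQ, fun v => ?_, fun v hv n => ?_⟩
  · rw [PowerSeries.X_dvd_iff, ← hd, ← PowerSeries.coeff_zero_eq_constantCoeff_apply]
    simp [digitExpansion]
  · have hv' : ∀ n, d ((Q ^ n) v) = 0 := fun n => by
      simpa [digitExpansion] using congrArg (PowerSeries.coeff n) hv
    have h2 : ∀ n, v = w ^ n * (Q ^ n) v := fun n => by
      induction n with
      | zero => simp
      | succ n ih =>
        have := hq ((Q ^ n) v)
        rw [hv', map_zero, zero_add] at this
        rw [pow_succ' Q, Module.End.mul_apply]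
        change _ = _ * q ((Q ^ n) v)
        rw [pow_succ, mul_assoc, ← this, ← ih]
    refine (pow_dvd_pow_of_dvd hN n).trans ?_
    rw [← pow_mul]
    exact ⟨_, h2 _⟩

open Polynomial in
/-- A torsion-free `k[X]`-algebra of finite rank is finite-dimensional modulo `X`. -/
theorem finite_quotient_span_algebraMap_X {k V : Type*} [Field k] [CommRing V]
    [Algebra k V] [Algebra k[X] V] [IsScalarTower k k[X] V] [Module.IsTorsionFree k[X] V]
    (h : Module.rank k[X] V < Cardinal.aleph0) :
    Module.Finite k (V ⧸ Ideal.span {algebraMap k[X] V X}) := by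
  obtain ⟨n, hn⟩ := Cardinal.lt_aleph0.1 h
  rw [← Module.rank_lt_aleph0_iff]
  refine (rank_le (n := n) fun t ht => ?_).trans_lt (Cardinal.natCast_lt_aleph0)
  choose g hg using fun i : t => Ideal.Quotient.mk_surjective i.1
  have step : ∀ p : t → k[X], ∑ i, p i • g i = 0 → ∀ i, X ∣ p i := fun p hp i => by
    rw [X_dvd_iff]
    refine Fintype.linearIndependent_iff.1 ht (fun i => (p i).coeff 0) ?_ i
    have := congrArg (Ideal.Quotient.mk (Ideal.span {algebraMap k[X] V X})) hp
    rw [map_sum, map_zero] at this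
    rw [← this]
    refine Finset.sum_congr rfl fun i _ => ?_
    rw [← hg i, ← Ideal.Quotient.mkₐ_eq_mk k, ← map_smul, Ideal.Quotient.mkₐ_eq_mk,
      Ideal.Quotient.mk_eq_mk_iff_sub_mem, Ideal.mem_span_singleton]
    have h1 : (p i).coeff 0 • g i = (C ((p i).coeff 0)) • g i := by
      rw [← algebraMap_eq, algebraMap_smul]
    rw [h1, ← sub_smul, Algebra.smul_def]
    refine Dvd.dvd.mul_right (_root_.map_dvd _ ?_) _
    rw [X_dvd_iff]; simp
  have pow : ∀ m, ∀ p : t → k[X], ∑ i, p i • g i = 0 → ∀ i, X ^ m ∣ p i := fun m => by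
    induction m with
    | zero => simp
    | succ m ih =>
      intro p hp i
      choose r hr using step p hp
      have : ∑ i, r i • g i = 0 := by
        refine (smul_eq_zero_iff_right (X_ne_zero (R := k))).1 ?_
        rw [Finset.smul_sum, ← hp]
        exact Finset.sum_congr rfl fun i _ => by rw [hr i, mul_smul]
      rw [hr i, pow_succ']
      exact mul_dvd_mul_left _ (ih r this i)
  have hli : LinearIndependent k[X] g := Fintype.linearIndependent_iff.2 fun p hp i => by
    ext j
    exact X_pow_dvd_iff.1 (pow (j + 1) p hp i) j (Nat.lt_succ_self j)
  have := hli.cardinal_lift_le_rank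
  rw [hn] at this
  simpa using this

/-- The localization of a domain at a prime is dominated by a valuation ring of its
fraction field. -/
theorem exists_valuationRing_dominating.{u} (B : Type u) [CommRing B] [IsDomain B]
    (n : Ideal B) [n.IsPrime] :
    ∃ (V : Type u) (_ : CommRing V) (_ : IsDomain V) (_ : ValuationRing V)
      (f : B →+* V) (g : V →+* FractionRing B), Function.Injective g ∧
      (∀ b, g (f b) = algebraMap B _ b) ∧
      (∀ b, f b ∈ IsLocalRing.maximalIdeal V ↔ b ∈ n) := by
  let g : Localization.AtPrime n →+* FractionRing B :=
    IsLocalization.lift (M := n.primeCompl) (g := algebraMap B (FractionRing B)) fun y =>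
      (IsUnit.mk0 _ (by
        simpa using fun h : (y : B) = 0 => y.2 (h ▸ n.zero_mem)))
  obtain ⟨V, hV, hloc⟩ := IsLocalRing.exists_factor_valuationRing g
  let f' : Localization.AtPrime n →+* V := g.codRestrict V.toSubring hV
  have : IsLocalHom f' := hloc
  refine ⟨V, inferInstance, inferInstance, inferInstance, f'.comp (algebraMap B _),
    V.subtype, Subtype.val_injective, fun b => ?_, fun b => ?_⟩
  · exact IsLocalization.lift_eq _ b
  · rw [← IsLocalization.AtPrime.to_map_mem_maximal_iff (Localization.AtPrime n) n b]
    simp only [IsLocalRing.mem_maximalIdeal, mem_nonunits_iff, RingHom.comp_apply]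
    rw [isUnit_map_iff f']

open Polynomial in
theorem rank_fractionRing_lt_aleph0 (k B : Type*) [Field k] [CommRing B] [IsDomain B]
    [Algebra k[X] B]
    [FaithfulSMul k[X] B] [Module.Finite k[X] B] :
    Module.rank k[X] (FractionRing B) < Cardinal.aleph0 := by
  let _ := FractionRing.liftAlgebra k[X] (FractionRing B)
  have : FiniteDimensional (FractionRing k[X]) (FractionRing B) :=
    .of_isLocalization k[X] B (nonZeroDivisors k[X])
  rw [← IsLocalization.rank_eq (FractionRing k[X]) (nonZeroDivisors k[X]) le_rfl]
  exact Module.rank_lt_aleph0 _ _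

open Polynomial in
/-- A branch of an affine curve, finite over the line, at a point above the origin. -/
theorem exists_injective_algHom_powerSeries {k B : Type*} [Field k] [IsAlgClosed k]
    [CommRing B] [IsDomain B] [Algebra k B]
    [Algebra k[X] B] [IsScalarTower k k[X] B] [FaithfulSMul k[X] B] [Module.Finite k[X] B]
    (n : Ideal B) [n.IsPrime] (hX : algebraMap k[X] B X ∈ n) :
    ∃ φ : B →ₐ[k] PowerSeries k,
      (∀ b, PowerSeries.X ∣ φ b ↔ b ∈ n) ∧ Function.Injective φ := by
  obtain ⟨V, _, _, _, f, g, hg, hf, hfn⟩ := exists_valuationRing_dominating B n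
  have hinj : Function.Injective f := fun a b h =>
    IsFractionRing.injective B (FractionRing B) (by rw [← hf, ← hf, h])
  let _ : Algebra k[X] V := (f.comp (algebraMap k[X] B)).toAlgebra
  let _ : Algebra k V := (f.comp (algebraMap k B)).toAlgebra
  have hkX : ∀ p, algebraMap k[X] V p = f (algebraMap k[X] B p) := fun _ => rfl
  have : IsScalarTower k k[X] V := .of_algebraMap_eq fun c => by
    rw [hkX, ← IsScalarTower.algebraMap_apply]; rfl
  have hXinj : Function.Injective (algebraMap k[X] V) :=
    hinj.comp (FaithfulSMul.algebraMap_injective k[X] B)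
  have : FaithfulSMul k[X] V := (faithfulSMul_iff_algebraMap_injective _ _).2 hXinj
  have : Module.IsTorsionFree k[X] V := inferInstance
  let ι : V →ₗ[k[X]] FractionRing B :=
    { toFun := g
      map_add' := map_add g
      map_smul' := fun p v => by
        rw [Algebra.smul_def, Algebra.smul_def, hkX, map_mul, hf,
          ← IsScalarTower.algebraMap_apply k[X] B, RingHom.id_apply] }
  have hrk : Module.rank k[X] V < Cardinal.aleph0 :=
    (LinearMap.rank_le_of_injective ι hg).trans_lt (rank_fractionRing_lt_aleph0 k B)
  have := finite_quotient_span_algebraMap_X hrk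
  have hs0 : algebraMap k[X] V X ≠ 0 := by
    rw [Ne, map_eq_zero_iff _ hXinj]; exact X_ne_zero
  have hsM : algebraMap k[X] V X ∈ IsLocalRing.maximalIdeal V := (hfn _).2 hX
  obtain ⟨φ, h1, h2⟩ := exists_algHom_powerSeries_of_finite_quotient (k := k)
    (algebraMap k[X] V X) hs0 hsM
  let F : B →ₐ[k] V := { f with commutes' := fun _ => rfl }
  refine ⟨φ.comp F, fun b => (h1 _).trans (hfn b), ?_⟩
  rw [injective_iff_map_eq_zero]
  intro b hb
  by_contra hb0
  have hcomap := Ideal.comap_ne_bot_of_integral_mem (R := k[X]) hb0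
    (Ideal.mem_span_singleton_self b) (Algebra.IsIntegral.isIntegral b)
  obtain ⟨p, hp, hp0⟩ := Submodule.exists_mem_ne_zero_of_ne_bot hcomap
  have hbp : b ∣ algebraMap k[X] B p := Ideal.mem_span_singleton.1 hp
  obtain ⟨q, hq, hXq⟩ := exists_eq_pow_rootMultiplicity_mul_and_not_dvd p hp0 0
  rw [C_0, sub_zero] at hq hXq
  set e := rootMultiplicity 0 p
  have hu : IsUnit (algebraMap k[X] V q) := by
    refine IsLocalRing.notMem_maximalIdeal.1 fun h => hXq ?_
    have hqX : algebraMap k[X] V (q - C (q.coeff 0)) ∈ IsLocalRing.maximalIdeal V := by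
      obtain ⟨r, hr⟩ : X ∣ q - C (q.coeff 0) := by rw [X_dvd_iff]; simp
      rw [hr, map_mul]
      exact Ideal.mul_mem_right _ _ hsM
    have hC : algebraMap k V (q.coeff 0) ∈ IsLocalRing.maximalIdeal V := by
      rw [IsScalarTower.algebraMap_apply k k[X] V, algebraMap_eq]
      simpa using sub_mem h hqX
    rw [X_dvd_iff]
    by_contra h0
    exact hC ((isUnit_iff_ne_zero.2 h0).map _)
  have hdvd : algebraMap k[X] V X ^ (e + 1) ∣ algebraMap k[X] V X ^ e := by
    refine (h2 _ hb (e + 1)).trans ?_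
    have := _root_.map_dvd f hbp
    rw [← hkX, hq, map_mul, map_pow] at this
    exact (hu.dvd_mul_right).1 this
  exact hsM (isUnit_of_dvd_one ((mul_dvd_mul_iff_left (pow_ne_zero e hs0)).1
    (by simpa [pow_succ] using hdvd)))

/-- Through a closed point of an affine variety where `f` vanishes passes a curve on which `f` is
not identically zero; it is a component of the preimage of a line under a Noether normalization. -/
theorem exists_prime_quotient_finite_over_polynomial {k A : Type*} [Field k] [IsAlgClosed k]
    [CommRing A] [IsDomain A] [Algebra k A] [Algebra.FiniteType k A]
    (m : Ideal A) [m.IsMaximal] (f : A) (hf : f ≠ 0) (hfm : f ∈ m) :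
    ∃ P ≤ m, P.IsPrime ∧ f ∉ P ∧ ∃ σ ∈ m,
      Function.Injective (Polynomial.aeval (R := k) (Ideal.Quotient.mk P σ)) ∧
      (Polynomial.aeval (R := k) (Ideal.Quotient.mk P σ)).Finite := by
  obtain ⟨n, g, hginj, hgfin⟩ := exists_finite_inj_algHom_of_fg k A
  let _ : Algebra (MvPolynomial (Fin n) k) A := g.toRingHom.toAlgebra
  have : Module.Finite (MvPolynomial (Fin n) k) A := hgfin
  have : FaithfulSMul (MvPolynomial (Fin n) k) A :=
    (faithfulSMul_iff_algebraMap_injective _ _).2 hginj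
  have hres : Function.Surjective (algebraMap k (A ⧸ m)) := by
    let _ := Ideal.Quotient.field m
    have := finite_of_finite_type_of_isJacobsonRing k (A ⧸ m)
    exact IsAlgClosed.algebraMap_bijective_of_isIntegral.2
  choose a ha using fun i => hres (Ideal.Quotient.mk m (g (MvPolynomial.X i)))
  have hpt : ∀ p, g p ∈ m ↔ MvPolynomial.aeval a p = 0 := fun p => by
    have h : (Ideal.Quotient.mkₐ k m).comp g =
        (Algebra.ofId k (A ⧸ m)).comp (MvPolynomial.aeval a) := by
      ext i
      simp [Algebra.ofId_apply, ha]
    have h' := DFunLike.congr_fun h p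
    simp only [AlgHom.comp_apply, Ideal.Quotient.mkₐ_eq_mk, Algebra.ofId_apply] at h'
    rw [← Ideal.Quotient.eq_zero_iff_mem, h', map_eq_zero_iff _ (algebraMap k (A ⧸ m)).injective]
  obtain ⟨p, hp, hp0⟩ := Submodule.exists_mem_ne_zero_of_ne_bot
    (Ideal.comap_ne_bot_of_integral_mem (R := MvPolynomial (Fin n) k) hf
      (Ideal.mem_span_singleton_self f) (Algebra.IsIntegral.isIntegral f))
  have hfp : f ∣ g p := Ideal.mem_span_singleton.1 hp
  obtain ⟨b, hb⟩ : ∃ b : Fin n → k, MvPolynomial.aeval b p ≠ 0 := by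
    by_contra! h
    exact hp0 (MvPolynomial.funext fun b => by simpa [MvPolynomial.aeval_eq_eval] using h b)
  obtain ⟨i, hi⟩ : ∃ i, b i - a i ≠ 0 := by
    by_contra! h
    have : b = a := funext fun i => sub_eq_zero.1 (h i)
    exact hb (this ▸ (hpt p).1 (m.mem_of_dvd hfp hfm))
  let ψ : MvPolynomial (Fin n) k →ₐ[k] Polynomial k :=
    MvPolynomial.aeval fun j => Polynomial.C (a j) + Polynomial.C (b j - a j) * Polynomial.X
  have hψ : ∀ (c : k) q, Polynomial.aeval c (ψ q) =
      MvPolynomial.aeval (fun j => a j + (b j - a j) * c) q := fun c q => by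
    rw [← AlgHom.comp_apply]
    congr 1
    ext j
    simp [ψ]
  let τ : MvPolynomial (Fin n) k :=
    MvPolynomial.C (b i - a i)⁻¹ * (MvPolynomial.X i - MvPolynomial.C (a i))
  have hτ : ψ τ = Polynomial.X := by
    have hC : ∀ c, ψ (MvPolynomial.C c) = Polynomial.C c := fun c => ψ.commutes c
    simp only [τ, map_mul, map_sub, hC]
    simp only [ψ, MvPolynomial.aeval_X, add_sub_cancel_left]
    rw [← mul_assoc, ← Polynomial.C_mul, inv_mul_cancel₀ hi, Polynomial.C_1, one_mul]
  have hψτ : ∀ q : Polynomial k, ψ (Polynomial.aeval τ q) = q := fun q => by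
    rw [← Polynomial.aeval_algHom_apply, hτ, Polynomial.aeval_X_left_apply]
  let p' := RingHom.ker ψ
  have hp' : p'.IsPrime := RingHom.ker_isPrime _
  have hle : p' ≤ m.under (MvPolynomial (Fin n) k) := fun q hq => by
    change g q ∈ m
    rw [hpt]
    simpa [(RingHom.mem_ker).1 hq] using (hψ 0 q).symm
  obtain ⟨P, hPm, hP, hPp⟩ := Ideal.exists_ideal_le_liesOver_of_le m hle
  have hmem : ∀ q, g q ∈ P ↔ ψ q = 0 := fun q => by
    rw [← RingHom.mem_ker]
    exact (Ideal.mem_of_liesOver P p' q).symm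
  refine ⟨P, hPm, hP, fun h => hb ?_, g τ, ?_, ?_, ?_⟩
  · simpa [(hmem p).1 (P.mem_of_dvd hfp h)] using (hψ 1 p).symm
  · rw [hpt]; simp [τ]
  · rw [injective_iff_map_eq_zero]
    intro q hq
    rw [← Ideal.Quotient.mkₐ_eq_mk k, Polynomial.aeval_algHom_apply,
      Polynomial.aeval_algHom_apply, Ideal.Quotient.mkₐ_eq_mk, Ideal.Quotient.eq_zero_iff_mem,
      hmem, hψτ] at hq
    exact hq
  · refine AlgHom.Finite.of_comp_finite (f := ψ) ?_
    have : (Polynomial.aeval (R := k) (Ideal.Quotient.mk P (g τ))).comp ψ =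
        (Ideal.Quotient.mkₐ k P).comp g := by
      refine AlgHom.ext fun q => ?_
      rw [AlgHom.comp_apply, AlgHom.comp_apply, ← Ideal.Quotient.mkₐ_eq_mk k,
        Polynomial.aeval_algHom_apply, Polynomial.aeval_algHom_apply, Ideal.Quotient.mkₐ_eq_mk,
        Ideal.Quotient.mk_eq_mk_iff_sub_mem, ← map_sub, hmem, map_sub, hψτ, sub_self]
    rw [this]
    exact AlgHom.Finite.comp (AlgHom.Finite.of_surjective _ Ideal.Quotient.mk_surjective) hgfin

/-- Some formal arc centred at `m` does not annihilate `f`. -/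
theorem exists_algHom_powerSeries_ne_zero {k A : Type*} [Field k] [IsAlgClosed k]
    [CommRing A] [IsDomain A] [Algebra k A] [Algebra.FiniteType k A]
    (m : Ideal A) [m.IsMaximal] (f : A) (hf : f ≠ 0)
    (hfm : f ∈ m) :
    ∃ φ : A →ₐ[k] PowerSeries k, (∀ a, PowerSeries.X ∣ φ a ↔ a ∈ m) ∧ φ f ≠ 0 := by
  obtain ⟨P, hPm, hP, hfP, σ, hσ, hinj, hfin⟩ :=
    exists_prime_quotient_finite_over_polynomial m f hf hfm (k := k)
  let _ := (Polynomial.aeval (R := k) (Ideal.Quotient.mk P σ)).toAlgebra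
  have : IsScalarTower k (Polynomial k) (A ⧸ P) :=
    .of_algebraMap_eq fun c => ((Polynomial.aeval (Ideal.Quotient.mk P σ)).commutes c).symm
  have : FaithfulSMul (Polynomial k) (A ⧸ P) := (faithfulSMul_iff_algebraMap_injective _ _).2 hinj
  have : Module.Finite (Polynomial k) (A ⧸ P) := hfin
  have hker : RingHom.ker (Ideal.Quotient.mk P) ≤ m := by rwa [Ideal.mk_ker]
  have hmem : ∀ a, Ideal.Quotient.mk P a ∈ m.map (Ideal.Quotient.mk P) ↔ a ∈ m := fun a => by
    rw [← Ideal.mem_comap, Ideal.comap_map_of_surjective' _ Ideal.Quotient.mk_surjective,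
      sup_eq_left.2 hker]
  have : (m.map (Ideal.Quotient.mk P)).IsPrime :=
    Ideal.map_isPrime_of_surjective Ideal.Quotient.mk_surjective hker
  obtain ⟨φ, h1, h2⟩ := exists_injective_algHom_powerSeries (k := k)
    (m.map (Ideal.Quotient.mk P)) (by
    change Polynomial.aeval _ _ ∈ _
    rw [Polynomial.aeval_X, hmem]
    exact hσ)
  refine ⟨φ.comp (Ideal.Quotient.mkₐ k P), fun a => (h1 _).trans (hmem a), fun h => hfP ?_⟩
  exact Ideal.Quotient.eq_zero_iff_mem.1 ((map_eq_zero_iff φ h2).1 h)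

/-- Let `k` be an algebraically closed field, `A` a finitely generated `k`-algebra which is an
integral domain of Krull dimension `d`, `m` a maximal ideal of `A`, and `I` a prime ideal with
`(0) ⊊ I ⊊ m` such that `0 < dim (A ⧸ I) = d₁ < d`.  Then there is a `k`-algebra homomorphism
`φ : A → k⟦t⟧` with `φ ⁻¹ ((t)) = m` and `I` not contained in the kernel of `φ`. -/
theorem stmt0 (k : Type*) [Field k] [IsAlgClosed k]
    (A : Type*) [CommRing A] [IsDomain A] [Algebra k A] [Algebra.FiniteType k A]
    (d d₁ : ℕ) (hd : ringKrullDim A = (d : WithBot (WithTop ℕ)))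
    (m : Ideal A) (hm : m.IsMaximal)
    (I : Ideal A) (hI : I.IsPrime) (hI0 : (⊥ : Ideal A) < I) (hIm : I < m)
    (hd₁ : ringKrullDim (A ⧸ I) = (d₁ : WithBot (WithTop ℕ)))
    (h0 : 0 < d₁) (h1 : d₁ < d) :
    ∃ φ : A →ₐ[k] PowerSeries k,
      Ideal.comap (φ : A →+* PowerSeries k)
          (Ideal.span ({PowerSeries.X} : Set (PowerSeries k))) = m ∧
      ¬ I ≤ RingHom.ker (φ : A →+* PowerSeries k) := by
  obtain ⟨f, hfI, hf0⟩ := Submodule.exists_mem_ne_zero_of_ne_bot hI0.ne'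
  obtain ⟨φ, h1, h2⟩ := exists_algHom_powerSeries_ne_zero (k := k) m f hf0 (hIm.le hfI)
  refine ⟨φ, ?_, fun h => h2 (h hfI)⟩
  ext a
  rw [Ideal.mem_comap, Ideal.mem_span_singleton]
  exact h1 a
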